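/- The map f × id : X × [0,1] → Y × [0,1], (p, t) ↦ (f(p), t), is a continuous surjection between continua that is not confluent: there exists a nonempty compact connected subset C of Y × [0,1] (namely C = ([1,2] × {0}) × [0,1]) and a connected component K of (f × id)⁻¹(C) such that (f × id)(K) ≠ C. -/

import Mathlib

open Set

/-- The `n`-th hair of the broom: `H n = {(t, t/2^n) : t ∈ [0,1]}`. -/
def hair (n : ℕ) : Set (ℝ × ℝ) := {p | ∃ t ∈ Icc (0:ℝ) 1, p = (t, t / 2 ^ n)}

/-- The Closed Infinite Broom `B = ([0,1] × {0}) ∪ ⋃ₙ H n`. -/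
def broom : Set (ℝ × ℝ) := (Icc (0:ℝ) 1 ×ˢ ({0} : Set ℝ)) ∪ ⋃ n, hair n

/-- The range space `Y = B ∪ ([1,2] × {0})`. -/
def Yset : Set (ℝ × ℝ) := broom ∪ (Icc (1:ℝ) 2 ×ˢ ({0} : Set ℝ))

/-- The domain space `X = B ∪ ({0} × [0,2])`. -/
def Xset : Set (ℝ × ℝ) := broom ∪ (({0} : Set ℝ) ×ˢ Icc (0:ℝ) 2)

open Classical in
/-- The map `f` : the identity on `B` and the rotation `(0,y) ↦ (y,0)` on the
extra hair `{0} × [0,2]`. -/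
noncomputable def fFun : ℝ × ℝ → ℝ × ℝ := fun p => if p ∈ broom then p else p.swap

/-- The product map `f × id : (p, t) ↦ (f p, t)`. -/
noncomputable def fProd : (ℝ × ℝ) × ℝ → (ℝ × ℝ) × ℝ := fun q => (fFun q.1, q.2)

/-- `X × [0,1]`. -/
def Xprod : Set ((ℝ × ℝ) × ℝ) := Xset ×ˢ Icc (0:ℝ) 1

/-- `Y × [0,1]`. -/
def Yprod : Set ((ℝ × ℝ) × ℝ) := Yset ×ˢ Icc (0:ℝ) 1

lemma broom_eq_image :
    broom = (fun p : ℝ × ℝ => (p.1, p.1 * p.2)) ''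
      (Icc (0:ℝ) 1 ×ˢ insert 0 (range fun n : ℕ => ((1:ℝ) / 2) ^ n)) := by
  ext ⟨a, b⟩
  simp only [broom, hair, mem_union, mem_prod, mem_singleton_iff, mem_iUnion, mem_ofPred_eq,
    mem_image, Prod.exists, mem_insert_iff, mem_range, Prod.mk.injEq]
  constructor
  · rintro (⟨ha, rfl⟩ | ⟨n, t, ht, rfl, rfl⟩)
    · exact ⟨a, 0, ⟨ha, Or.inl rfl⟩, rfl, by simp⟩
    · exact ⟨a, _, ⟨ht, Or.inr ⟨n, rfl⟩⟩, rfl, by rw [one_div, inv_pow, div_eq_mul_inv]⟩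
  · rintro ⟨t, s, ⟨ht, rfl | ⟨n, rfl⟩⟩, rfl, rfl⟩
    · exact Or.inl ⟨ht, by simp⟩
    · exact Or.inr ⟨n, t, ht, rfl, by rw [one_div, inv_pow, div_eq_mul_inv]⟩

lemma isCompact_broom : IsCompact broom := by
  rw [broom_eq_image]
  have h : IsCompact (insert 0 (range fun n : ℕ => ((1:ℝ) / 2) ^ n)) :=
    (tendsto_pow_atTop_nhds_zero_of_lt_one (by norm_num) (by norm_num)).isCompact_insert_range
  exact (isCompact_Icc.prod h).image (by fun_prop)

lemma starConvex_broom : StarConvex ℝ 0 broom := by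
  rw [starConvex_zero_iff, broom_eq_image]
  rintro _ ⟨⟨t, s⟩, ⟨ht, hs⟩, rfl⟩ a ha₀ ha₁
  refine ⟨(a * t, s), ⟨⟨mul_nonneg ha₀ ht.1, mul_le_one₀ ha₁ ht.1 ht.2⟩, hs⟩, ?_⟩
  simp [mul_assoc]

lemma fst_mem_Icc_of_mem_broom {p : ℝ × ℝ} (hp : p ∈ broom) : p.1 ∈ Icc (0:ℝ) 1 := by
  rw [broom_eq_image] at hp
  obtain ⟨q, hq, rfl⟩ := hp
  exact hq.1

lemma snd_eq_zero_of_mem_broom {p : ℝ × ℝ} (hp : p ∈ broom) (h : p.1 = 0) : p.2 = 0 := by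
  rw [broom_eq_image] at hp
  obtain ⟨q, hq, rfl⟩ := hp
  simp only at h
  simp [h]

lemma mk_zero_mem_broom {t : ℝ} (ht : t ∈ Icc (0:ℝ) 1) : (t, (0:ℝ)) ∈ broom :=
  Or.inl ⟨ht, rfl⟩

lemma Yset_eq : Yset = broom ∪ Icc (0:ℝ) 2 ×ˢ ({0} : Set ℝ) := by
  ext ⟨a, b⟩
  constructor
  · rintro (h | ⟨⟨h₁, h₂⟩, h₃⟩)
    · exact Or.inl h
    · exact Or.inr ⟨⟨zero_le_one.trans h₁, h₂⟩, h₃⟩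
  · rintro (h | ⟨⟨h₁, h₂⟩, h₃⟩)
    · exact Or.inl h
    · rcases le_total a 1 with h | h
      · exact Or.inl (Or.inl ⟨⟨h₁, h⟩, h₃⟩)
      · exact Or.inr ⟨⟨h, h₂⟩, h₃⟩

lemma starConvex_Xset : StarConvex ℝ 0 Xset := by
  refine starConvex_broom.union (Convex.starConvex ?_ (by simp))
  exact (convex_singleton 0).prod (convex_Icc 0 2)

lemma starConvex_Yset : StarConvex ℝ 0 Yset := by
  rw [Yset_eq]
  refine starConvex_broom.union (Convex.starConvex ?_ (by simp))
  exact (convex_Icc 0 2).prod (convex_singleton 0)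

lemma isCompact_Xset : IsCompact Xset :=
  isCompact_broom.union (isCompact_singleton.prod isCompact_Icc)

lemma isCompact_Yset : IsCompact Yset :=
  isCompact_broom.union (isCompact_Icc.prod isCompact_singleton)

lemma zero_mem_broom : (0 : ℝ × ℝ) ∈ broom := mk_zero_mem_broom (by simp)

lemma isConnected_Xset : IsConnected Xset :=
  (starConvex_Xset.isPathConnected (Or.inl zero_mem_broom)).isConnected

lemma isConnected_Yset : IsConnected Yset :=
  (starConvex_Yset.isPathConnected (Or.inl zero_mem_broom)).isConnected

lemma fFun_of_mem_broom {p : ℝ × ℝ} (hp : p ∈ broom) : fFun p = p := if_pos hp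

lemma fFun_zero_mk (y : ℝ) : fFun (0, y) = (y, 0) := by
  by_cases h : ((0:ℝ), y) ∈ broom
  · obtain rfl : y = 0 := snd_eq_zero_of_mem_broom h rfl
    exact fFun_of_mem_broom h
  · exact if_neg h

lemma continuousOn_fFun : ContinuousOn fFun Xset := by
  refine ContinuousOn.union_of_isClosed ?_ ?_ isCompact_broom.isClosed
    (isClosed_singleton.prod isClosed_Icc)
  · exact continuousOn_id.congr fun p hp => fFun_of_mem_broom hp
  · refine continuous_swap.continuousOn.congr ?_
    rintro ⟨x, y⟩ ⟨rfl, -⟩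
    exact fFun_zero_mk y

lemma mapsTo_fFun : MapsTo fFun Xset Yset := by
  rintro ⟨x, y⟩ (h | ⟨rfl, hy⟩)
  · rw [fFun_of_mem_broom h]
    exact Or.inl h
  · rw [fFun_zero_mk, Yset_eq]
    exact Or.inr ⟨hy, rfl⟩

lemma surjOn_fFun : SurjOn fFun Xset Yset := by
  rintro ⟨x, y⟩ (h | ⟨⟨h₁, h₂⟩, rfl⟩)
  · exact ⟨_, Or.inl h, fFun_of_mem_broom h⟩
  · exact ⟨(0, x), Or.inr ⟨rfl, zero_le_one.trans h₁, h₂⟩, fFun_zero_mk x⟩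

lemma mem_preimage_product :
    (((1:ℝ), (0:ℝ)), (0:ℝ)) ∈
      Xprod ∩ fProd ⁻¹' ((Icc (1:ℝ) 2 ×ˢ ({0} : Set ℝ)) ×ˢ Icc (0:ℝ) 1) := by
  have h : ((1:ℝ), (0:ℝ)) ∈ broom := mk_zero_mem_broom (by simp)
  refine ⟨⟨Or.inl h, by simp⟩, ?_⟩
  simp [fProd, fFun_of_mem_broom h]

/-- The component of `((1, 0), 0)` in the preimage of `([1,2] × {0}) × [0,1]` stays over the first
coordinate `1`, so its image misses `((2, 0), 0)`. -/
lemma image_connectedComponentIn_ne :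
    fProd '' connectedComponentIn
      (Xprod ∩ fProd ⁻¹' ((Icc (1:ℝ) 2 ×ˢ ({0} : Set ℝ)) ×ˢ Icc (0:ℝ) 1)) ((1, 0), 0) ≠
      (Icc (1:ℝ) 2 ×ˢ ({0} : Set ℝ)) ×ˢ Icc (0:ℝ) 1 := by
  set F := Xprod ∩ fProd ⁻¹' ((Icc (1:ℝ) 2 ×ˢ ({0} : Set ℝ)) ×ˢ Icc (0:ℝ) 1)
  intro heq
  have h2 : (((2:ℝ), (0:ℝ)), (0:ℝ)) ∈ (Icc (1:ℝ) 2 ×ˢ ({0} : Set ℝ)) ×ˢ Icc (0:ℝ) 1 := by simp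
  rw [← heq] at h2
  obtain ⟨q, hq, hq2⟩ := h2
  have hf : fFun q.1 = (2, 0) := congrArg Prod.fst hq2
  have hq0 : q.1.1 = 0 := by
    rcases (connectedComponentIn_subset _ _ hq).1.1 with h | h
    · have h1 := (fst_mem_Icc_of_mem_broom h).2
      rw [fFun_of_mem_broom h] at hf
      norm_num [hf] at h1
    · exact h.1
  have hpre : IsPreconnected
      ((fun q : (ℝ × ℝ) × ℝ => q.1.1) '' connectedComponentIn F ((1, 0), 0)) :=
    isPreconnected_connectedComponentIn.image _ (by fun_prop)
  obtain ⟨r, hr, hr2⟩ := hpre.Icc_subset ⟨q, hq, hq0⟩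
    ⟨_, mem_connectedComponentIn mem_preimage_product, rfl⟩ (show (1 / 2 : ℝ) ∈ Icc (0:ℝ) 1 by norm_num)
  have hrF := connectedComponentIn_subset _ _ hr
  simp only at hr2
  rcases hrF.1.1 with h | h
  · have h1 : 1 ≤ (fFun r.1).1 := hrF.2.1.1.1
    rw [fFun_of_mem_broom h, hr2] at h1
    norm_num at h1
  · have h1 : r.1.1 = 0 := h.1
    norm_num [h1] at hr2

/-- `f × id : X × [0,1] → Y × [0,1]` is a continuous surjection between continua
which is not confluent: there are a nonempty compact connected subset `C` of
`Y × [0,1]` and a connected component of `(f × id)⁻¹(C)` whose image is not `C`. -/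
theorem fProd_not_confluent :
    Xprod.Nonempty ∧ IsCompact Xprod ∧ IsConnected Xprod ∧
    Yprod.Nonempty ∧ IsCompact Yprod ∧ IsConnected Yprod ∧
    Set.MapsTo fProd Xprod Yprod ∧ ContinuousOn fProd Xprod ∧ Set.SurjOn fProd Xprod Yprod ∧
    ∃ C : Set ((ℝ × ℝ) × ℝ), C ⊆ Yprod ∧ C.Nonempty ∧ IsCompact C ∧ IsConnected C ∧
      ∃ x ∈ Xprod ∩ fProd ⁻¹' C,
        fProd '' connectedComponentIn (Xprod ∩ fProd ⁻¹' C) x ≠ C := by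
  have hI : IsConnected (Icc (0:ℝ) 1) := isConnected_Icc zero_le_one
  have hX : IsConnected Xprod := isConnected_Xset.prod hI
  have hY : IsConnected Yprod := isConnected_Yset.prod hI
  have hC : IsConnected ((Icc (1:ℝ) 2 ×ˢ ({0} : Set ℝ)) ×ˢ Icc (0:ℝ) 1) :=
    ((isConnected_Icc one_le_two).prod isConnected_singleton).prod hI
  refine ⟨hX.nonempty, isCompact_Xset.prod isCompact_Icc, hX, hY.nonempty,
    isCompact_Yset.prod isCompact_Icc, hY, mapsTo_fFun.prodMap (mapsTo_id _),
    continuousOn_fFun.prodMap continuousOn_id, surjOn_fFun.prodMap (surjOn_id _),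
    _, prod_mono subset_union_right Subset.rfl, hC.nonempty,
    (isCompact_Icc.prod isCompact_singleton).prod isCompact_Icc, hC, ((1, 0), 0),
    mem_preimage_product, image_connectedComponentIn_ne⟩
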